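/- There is an absolute constant C such that the following holds. For every simple graph G on n ≥ 2 vertices, every integer k ≥ 1, all independent sets S and T of G of size k, and every integer ℓ ≥ 1, there exists a CNF formula φ with at most (n + ℓ + k)^C variables and clauses, together with a path decomposition of φ of width at most k·⌈log₂ n⌉ + C·k, such that φ is satisfiable if and only if S can be transformed into T by at most ℓ token-jumping moves in G. -/

import Mathlib

open scoped Classical

namespace PPSETH

abbrev Var := ℕ
abbrev Clause := Finset (Var × Bool)
abbrev CNF := List Clause

/-- The set of variables occurring in a clause. -/
def clauseVars (c : Clause) : Finset Var := c.image Prod.fst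

/-- The set of variables occurring in a CNF formula. -/
def cnfVars (φ : CNF) : Finset Var := φ.foldr (fun c s => clauseVars c ∪ s) ∅

/-- An assignment satisfies a clause if the clause contains a literal it makes true. -/
def SatC (τ : Var → Bool) (c : Clause) : Prop := ∃ l ∈ c, τ l.1 = l.2

/-- An assignment satisfies a CNF formula if it satisfies every clause. -/
def Sat (τ : Var → Bool) (φ : CNF) : Prop := ∀ c ∈ φ, SatC τ c

def Satisfiable (φ : CNF) : Prop := ∃ τ, Sat τ φ

/-- Size of a CNF formula: number of variables plus total number of literal occurrences. -/
def size (φ : CNF) : ℕ := (cnfVars φ).card + (φ.map Finset.card).sum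

/-- Weight of an assignment: the number of variables of the formula set to true. -/
def weight (φ : CNF) (τ : Var → Bool) : ℕ :=
  ((cnfVars φ).filter (fun x => τ x = true)).card

/-- The number of clauses (with multiplicity) satisfied by an assignment. -/
noncomputable def satCount (φ : CNF) (τ : Var → Bool) : ℕ :=
  (φ.map (fun c => if SatC τ c then 1 else 0)).sum

/-- Number of clauses (with multiplicity) in which a variable occurs. -/
noncomputable def occs (φ : CNF) (x : Var) : ℕ :=
  (φ.map (fun c => if x ∈ clauseVars c then 1 else 0)).sum

/-- A k-CNF formula: every clause has at most k literals. -/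
def IsKCNF (k : ℕ) (φ : CNF) : Prop := ∀ c ∈ φ, c.card ≤ k

/-- Structural conditions for a path decomposition of (the primal graph of) a CNF formula. -/
def PDOn (φ : CNF) (B : List (Finset Var)) : Prop :=
  (∀ b ∈ B, b ⊆ cnfVars φ) ∧
  (∀ x ∈ cnfVars φ, ∃ b ∈ B, x ∈ b) ∧
  (∀ c ∈ φ, ∃ b ∈ B, clauseVars c ⊆ b) ∧
  (∀ x : Var, ∀ i j k : ℕ, i ≤ j → j ≤ k →
    x ∈ B.getD i ∅ → x ∈ B.getD k ∅ → x ∈ B.getD j ∅)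

/-- A path decomposition of a CNF formula of width `p`: bags have size at most `p + 1`. -/
def PD (φ : CNF) (p : ℕ) (B : List (Finset Var)) : Prop :=
  PDOn φ B ∧ ∀ b ∈ B, b.card ≤ p + 1


/-- A finset of vertices is independent in a simple graph. -/
def IndepSet {V : Type*} (G : SimpleGraph V) (S : Finset V) : Prop :=
  ∀ u ∈ S, ∀ v ∈ S, ¬ G.Adj u v

/-- `S` can be transformed into `T` by at most `ℓ` token-jumping moves in `G`, keeping an
independent set of size `k` at all times: there is a sequence of at most `ℓ + 1`
independent sets of size `k`, starting with `S` and ending with `T`, in which each set is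
obtained from the previous one by removing one vertex and adding one vertex. -/
def TJReach {V : Type*} [DecidableEq V] (G : SimpleGraph V) (k ℓ : ℕ)
    (S T : Finset V) : Prop :=
  ∃ L : List (Finset V), L ≠ [] ∧ L.length ≤ ℓ + 1 ∧
    L.head? = some S ∧ L.getLast? = some T ∧
    (∀ A ∈ L, A.card = k ∧ IndepSet G A) ∧
    L.Chain' (fun A A' => (A \ A').card = 1 ∧ (A' \ A).card = 1)

section Families

/-- The formula listing the clauses `f i` for all `i` satisfying `P`. -/
noncomputable def family {ι : Type*} [Fintype ι] (P : ι → Prop) (f : ι → Clause) : CNF :=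
  (Finset.univ.filter P).toList.map f

lemma mem_family {ι : Type*} [Fintype ι] {P : ι → Prop} {f : ι → Clause} {c : Clause} :
    c ∈ family P f ↔ ∃ i, P i ∧ f i = c := by
  simp [family]

lemma length_family_le {ι : Type*} [Fintype ι] (P : ι → Prop) (f : ι → Clause) :
    (family P f).length ≤ Fintype.card ι := by
  simpa [family] using Finset.card_le_univ (Finset.univ.filter P)

lemma sat_family {ι : Type*} [Fintype ι] {P : ι → Prop} {f : ι → Clause} {τ : Var → Bool} :
    Sat τ (family P f) ↔ ∀ i, P i → SatC τ (f i) := by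
  constructor
  · intro h i hi
    exact h _ (mem_family.2 ⟨i, hi, rfl⟩)
  · intro h c hc
    obtain ⟨i, hi, rfl⟩ := mem_family.1 hc
    exact h i hi

lemma sat_append {τ : Var → Bool} {φ ψ : CNF} : Sat τ (φ ++ ψ) ↔ Sat τ φ ∧ Sat τ ψ := by
  simp [Sat, or_imp, forall_and]

lemma satC_union {τ : Var → Bool} {c d : Clause} : SatC τ (c ∪ d) ↔ SatC τ c ∨ SatC τ d := by
  simp only [SatC, Finset.mem_union, or_and_right, exists_or]

lemma mem_cnfVars {φ : CNF} {x : Var} : x ∈ cnfVars φ ↔ ∃ c ∈ φ, x ∈ clauseVars c := by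
  unfold cnfVars
  induction φ with
  | nil => simp
  | cons c φ ih => simp only [List.foldr_cons, Finset.mem_union, ih, List.mem_cons, exists_eq_or_imp]

end Families

section Windows

/-- The sliding windows `[t, t + W]` for `t ≤ N`, restricted to the variables of `φ`. -/
def windows (φ : CNF) (N W : ℕ) : List (Finset Var) :=
  (List.range (N + 1)).map fun t => Finset.Icc t (t + W) ∩ cnfVars φ

lemma mem_windows_getD {φ : CNF} {N W i x : ℕ} :
    x ∈ (windows φ N W).getD i ∅ ↔ i ≤ N ∧ (i ≤ x ∧ x ≤ i + W) ∧ x ∈ cnfVars φ := by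
  by_cases h : i < N + 1
  · simp [windows, List.getD, h, Nat.lt_succ_iff.1 h]
  · have h' : ¬ i ≤ N := by omega
    simp [windows, List.getD, h, h']

lemma pd_windows {φ : CNF} {N W p : ℕ} (hp : W ≤ p)
    (h : ∀ c ∈ φ, ∃ t ≤ N, ∀ x : ℕ, x ∈ clauseVars c → t ≤ x ∧ x ≤ t + W) :
    PD φ p (windows φ N W) := by
  have cover : ∀ c ∈ φ, ∃ b ∈ windows φ N W, clauseVars c ⊆ b := by
    intro c hc
    obtain ⟨t, ht, hx⟩ := h c hc
    refine ⟨Finset.Icc t (t + W) ∩ cnfVars φ,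
      List.mem_map.2 ⟨t, List.mem_range.2 (by omega), rfl⟩, fun x hxc => ?_⟩
    exact Finset.mem_inter.2 ⟨Finset.mem_Icc.2 (hx x hxc), mem_cnfVars.2 ⟨c, hc, hxc⟩⟩
  refine ⟨⟨?_, ?_, cover, ?_⟩, ?_⟩
  · intro b hb
    obtain ⟨t, -, rfl⟩ := List.mem_map.1 hb
    exact Finset.inter_subset_right
  · intro x hx
    obtain ⟨c, hc, hxc⟩ := mem_cnfVars.1 hx
    obtain ⟨b, hb, hcb⟩ := cover c hc
    exact ⟨b, hb, hcb hxc⟩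
  · intro (x : ℕ) i j k hij hjk hi hk
    rw [mem_windows_getD] at *
    refine ⟨?_, ⟨?_, ?_⟩, hi.2.2⟩ <;> omega
  · intro b hb
    obtain ⟨t, -, rfl⟩ := List.mem_map.1 hb
    refine (Finset.card_le_card Finset.inter_subset_left).trans ?_
    rw [Nat.card_Icc]
    omega

lemma card_cnfVars_le_of_windows {φ : CNF} {N W : ℕ}
    (h : ∀ c ∈ φ, ∃ t ≤ N, ∀ x : ℕ, x ∈ clauseVars c → t ≤ x ∧ x ≤ t + W) :
    (cnfVars φ).card ≤ N + W + 1 := by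
  have : cnfVars φ ⊆ Finset.range (N + W + 1) := by
    intro (x : ℕ) hx
    obtain ⟨c, hc, hxc⟩ := mem_cnfVars.1 hx
    obtain ⟨t, ht, htx⟩ := h c hc
    have := htx x hxc
    exact Finset.mem_range.2 (by omega)
  simpa using Finset.card_le_card this

end Windows

section Trajectories

variable {V : Type*} (G : SimpleGraph V)

/-- The tokens of a placement occupy distinct, pairwise non-adjacent vertices. -/
def Spread {k : ℕ} (f : Fin k → V) : Prop :=
  ∀ j j', j ≠ j' → f j ≠ f j' ∧ ¬ G.Adj (f j) (f j')

/-- A sequence of `ℓ + 1` placements of `k` labelled tokens on independent sets, in which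
consecutive placements differ in at most one token. -/
def IsTrajectory {k : ℕ} (ℓ : ℕ) (F : ℕ → Fin k → V) : Prop :=
  (∀ i ≤ ℓ, Spread G (F i)) ∧
    ∀ i < ℓ, ∀ j j', j ≠ j' → F i j = F (i + 1) j ∨ F i j' = F (i + 1) j'

variable {G}

lemma Spread.injective {k : ℕ} {f : Fin k → V} (h : Spread G f) : Function.Injective f := by
  intro j j' hj
  by_contra hne
  exact (h j j' hne).1 hj

lemma spread_of_indepSet {k : ℕ} {f : Fin k → V} {A : Finset V} (hA : IndepSet G A)
    (hf : Function.Injective f) (hfA : ∀ j, f j ∈ A) : Spread G f :=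
  fun j j' hj => ⟨hf.ne hj, hA _ (hfA j) _ (hfA j')⟩

variable [DecidableEq V]

lemma Spread.indepSet_image {k : ℕ} {f : Fin k → V} (h : Spread G f) :
    IndepSet G (Finset.univ.image f) := by
  intro u hu v hv
  obtain ⟨j, -, rfl⟩ := Finset.mem_image.1 hu
  obtain ⟨j', -, rfl⟩ := Finset.mem_image.1 hv
  by_cases hj : j = j'
  · subst hj; exact G.irrefl
  · exact (h j j' hj).2

lemma Spread.card_image {k : ℕ} {f : Fin k → V} (h : Spread G f) :
    (Finset.univ.image f).card = k := by
  rw [Finset.card_image_of_injective _ h.injective, Finset.card_fin]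

lemma Spread.image_eq {k : ℕ} {f : Fin k → V} (h : Spread G f) {S : Finset V}
    (hS : S.card = k) (hf : ∀ j, f j ∈ S) : Finset.univ.image f = S := by
  apply Finset.eq_of_subset_of_card_le
  · intro v hv
    obtain ⟨j, -, rfl⟩ := Finset.mem_image.1 hv
    exact hf j
  · rw [h.card_image, hS]

lemma card_image_sdiff_image_le_one {k : ℕ} {f g : Fin k → V}
    (h : ∀ j j', j ≠ j' → f j = g j ∨ f j' = g j') :
    (Finset.univ.image f \ Finset.univ.image g).card ≤ 1 := by
  rw [Finset.card_le_one]
  intro u hu v hv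
  simp only [Finset.mem_sdiff, Finset.mem_image, Finset.mem_univ, true_and, not_exists] at hu hv
  obtain ⟨⟨j, rfl⟩, hj⟩ := hu
  obtain ⟨⟨j', rfl⟩, hj'⟩ := hv
  by_contra hne
  have hjj : j ≠ j' := fun e => hne (by rw [e])
  rcases h j j' hjj with e | e
  · exact hj j e.symm
  · exact hj' j' e.symm

lemma IsTrajectory.tjReach {k ℓ : ℕ} {F : ℕ → Fin k → V} (h : IsTrajectory G ℓ F) :
    TJReach G k ℓ (Finset.univ.image (F 0)) (Finset.univ.image (F ℓ)) := by
  induction ℓ generalizing F with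
  | zero =>
    refine ⟨[Finset.univ.image (F 0)], by simp, by simp, rfl, rfl, ?_, List.isChain_singleton _⟩
    intro A hA
    rw [List.mem_singleton] at hA
    subst hA
    exact ⟨(h.1 0 le_rfl).card_image, (h.1 0 le_rfl).indepSet_image⟩
  | succ ℓ ih =>
    have h' : IsTrajectory G ℓ (fun i => F (i + 1)) :=
      ⟨fun i hi => h.1 (i + 1) (by omega), fun i hi => h.2 (i + 1) (by omega)⟩
    obtain ⟨L, hne, hlen, hhead, hlast, hall, hchain⟩ := ih h'
    by_cases heq : Finset.univ.image (F 0) = Finset.univ.image (F 1)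
    · refine ⟨L, hne, by omega, ?_, hlast, hall, hchain⟩
      rw [heq]
      exact hhead
    · obtain ⟨A, M, rfl⟩ := List.exists_cons_of_ne_nil hne
      obtain rfl : A = Finset.univ.image (F 1) := by simpa using hhead
      have s0 := h.1 0 (by omega)
      have s1 := h.1 1 (by omega)
      have step := h.2 0 (by omega)
      have le01 := card_image_sdiff_image_le_one step
      have hcomm : (Finset.univ.image (F 0) \ Finset.univ.image (F 1)).card =
          (Finset.univ.image (F 1) \ Finset.univ.image (F 0)).card :=
        Finset.card_sdiff_comm (s0.card_image.trans s1.card_image.symm)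
      have hpos : 0 < (Finset.univ.image (F 0) \ Finset.univ.image (F 1)).card := by
        rw [Finset.card_pos, Finset.sdiff_nonempty]
        intro hsub
        exact heq (Finset.eq_of_subset_of_card_le hsub
          (s1.card_image.trans s0.card_image.symm).le)
      have h01 : (Finset.univ.image (F 0) \ Finset.univ.image (F 1)).card = 1 :=
        le_antisymm le01 hpos
      refine ⟨Finset.univ.image (F 0) :: Finset.univ.image (F 1) :: M, by simp,
        by simpa using hlen, rfl, ?_, ?_, ?_⟩
      · rw [List.getLast?_cons_cons]
        exact hlast
      · intro A hA
        rcases List.mem_cons.1 hA with rfl | hA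
        · exact ⟨s0.card_image, s0.indepSet_image⟩
        · exact hall A hA
      · exact List.isChain_cons_cons.2 ⟨⟨h01, hcomm ▸ h01⟩, hchain⟩

/-- A token-jumping move between vertex sets lifts to a move of one labelled token. -/
lemma exists_placement_of_move {k : ℕ} {f : Fin k → V} {A A' : Finset V}
    (hf : Function.Injective f) (hfA : ∀ j, f j ∈ A) (hcard : A.card = k)
    (h : (A \ A').card = 1) (h' : (A' \ A).card = 1) :
    ∃ g : Fin k → V, Function.Injective g ∧ (∀ j, g j ∈ A') ∧
      ∀ j j', j ≠ j' → f j = g j ∨ f j' = g j' := by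
  obtain ⟨a, ha⟩ := Finset.card_eq_one.1 h
  obtain ⟨b, hb⟩ := Finset.card_eq_one.1 h'
  have hbA : b ∈ A' \ A := hb ▸ Finset.mem_singleton_self b
  rw [Finset.mem_sdiff] at hbA
  have haA : a ∈ A \ A' := ha ▸ Finset.mem_singleton_self a
  rw [Finset.mem_sdiff] at haA
  have himg : Finset.univ.image f = A := by
    apply Finset.eq_of_subset_of_card_le
    · intro v hv
      obtain ⟨j, -, rfl⟩ := Finset.mem_image.1 hv
      exact hfA j
    · rw [Finset.card_image_of_injective _ hf, Finset.card_fin, hcard]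
  obtain ⟨j₀, -, hj₀⟩ := Finset.mem_image.1 (himg ▸ haA.1 : a ∈ Finset.univ.image f)
  refine ⟨Function.update f j₀ b, ?_, ?_, ?_⟩
  · have hfb : ∀ j, f j ≠ b := fun j e => hbA.2 (e ▸ hfA j)
    intro j j' hj
    by_cases e : j = j₀ <;> by_cases e' : j' = j₀
    · rw [e, e']
    · subst e
      rw [Function.update_self, Function.update_of_ne e'] at hj
      exact absurd hj.symm (hfb j')
    · subst e'
      rw [Function.update_self, Function.update_of_ne e] at hj
      exact absurd hj (hfb j)
    · rw [Function.update_of_ne e, Function.update_of_ne e'] at hj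
      exact hf hj
  · intro j
    by_cases e : j = j₀
    · subst e
      rw [Function.update_self]
      exact hbA.1
    · rw [Function.update_of_ne e]
      by_contra hn
      have : f j ∈ A \ A' := Finset.mem_sdiff.2 ⟨hfA j, hn⟩
      rw [ha, Finset.mem_singleton, ← hj₀] at this
      exact e (hf this)
  · intro j j' hj
    by_cases e : j = j₀
    · right
      rw [Function.update_of_ne (fun e' => hj (e.trans e'.symm))]
    · left
      rw [Function.update_of_ne e]

lemma exists_isTrajectory_of_chain {k : ℕ} {A T : Finset V} {M : List (Finset V)} {ℓ : ℕ}
    {f : Fin k → V} (hlen : M.length ≤ ℓ) (hlast : (A :: M).getLast? = some T)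
    (hall : ∀ B ∈ A :: M, B.card = k ∧ IndepSet G B)
    (hchain : (A :: M).IsChain fun B B' => (B \ B').card = 1 ∧ (B' \ B).card = 1)
    (hf : Function.Injective f) (hfA : ∀ j, f j ∈ A) :
    ∃ F : ℕ → Fin k → V, IsTrajectory G ℓ F ∧ F 0 = f ∧ ∀ j, F ℓ j ∈ T := by
  induction M generalizing A ℓ f with
  | nil =>
    have hAT : A = T := by simpa using hlast
    have hs := spread_of_indepSet (hall A (by simp)).2 hf hfA
    exact ⟨fun _ => f, ⟨fun _ _ => hs, fun _ _ _ _ _ => Or.inl rfl⟩, rfl, hAT ▸ hfA⟩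
  | cons A' M ih =>
    obtain ⟨ℓ, rfl⟩ : ∃ m, ℓ = m + 1 := ⟨ℓ - 1, by simp at hlen; omega⟩
    obtain ⟨⟨h, h'⟩, hchain'⟩ := List.isChain_cons_cons.1 hchain
    obtain ⟨hA, hAind⟩ := hall A (by simp)
    obtain ⟨g, hg, hgA, hfg⟩ := exists_placement_of_move hf hfA hA h h'
    obtain ⟨F, hF, hF0, hFT⟩ := ih (ℓ := ℓ) (by simpa using hlen)
      (by rwa [List.getLast?_cons_cons] at hlast)
      (fun B hB => hall B (List.mem_cons_of_mem _ hB)) hchain' hg hgA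
    refine ⟨fun i => Nat.casesOn i f F, ⟨?_, ?_⟩, rfl, hFT⟩
    · rintro (_ | i) hi
      · exact spread_of_indepSet hAind hf hfA
      · exact hF.1 i (by omega)
    · rintro (_ | i) hi
      · intro j j' hj
        simpa [hF0] using hfg j j' hj
      · exact hF.2 i (by omega)

/-- Token-jumping reachability in terms of labelled tokens. -/
lemma tjReach_iff_exists_isTrajectory {k ℓ : ℕ} {S T : Finset V} (hS : S.card = k)
    (hT : T.card = k) :
    TJReach G k ℓ S T ↔
      ∃ F : ℕ → Fin k → V, IsTrajectory G ℓ F ∧ (∀ j, F 0 j ∈ S) ∧ ∀ j, F ℓ j ∈ T := by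
  constructor
  · rintro ⟨L, hne, hlen, hhead, hlast, hall, hchain⟩
    obtain ⟨A, M, rfl⟩ := List.exists_cons_of_ne_nil hne
    simp only [List.head?_cons, Option.some.injEq] at hhead
    subst hhead
    let f : Fin k → V := fun j => (A.equivFinOfCardEq hS).symm j
    have hf : Function.Injective f :=
      Subtype.val_injective.comp (A.equivFinOfCardEq hS).symm.injective
    have hfA : ∀ j, f j ∈ A := fun j => ((A.equivFinOfCardEq hS).symm j).2
    obtain ⟨F, hF, hF0, hFT⟩ := exists_isTrajectory_of_chain (by simpa using hlen) hlast
      hall hchain hf hfA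
    exact ⟨F, hF, fun j => hF0 ▸ hfA j, hFT⟩
  · rintro ⟨F, hF, hS', hT'⟩
    have := hF.tjReach
    rwa [(hF.1 0 (Nat.zero_le _)).image_eq hS hS', (hF.1 ℓ le_rfl).image_eq hT hT'] at this

end Trajectories

section Encoding

/-- The variables attached to one time step: `b` bits for each of `k` tokens, and one flag
for each token. -/
abbrev Slot (k b : ℕ) := (Fin k × Fin b) ⊕ Fin k

/-- The flags come after the bits. -/
def slotEquiv (k b : ℕ) : Slot k b ≃ Fin (k * b + k) :=
  (Equiv.sumCongr finProdFinEquiv (Equiv.refl _)).trans finSumFinEquiv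

/-- The variable for slot `p` at time `i`. -/
def slotVar (k b i : ℕ) (p : Slot k b) : ℕ := i * (k * b + k) + slotEquiv k b p

lemma slotEquiv_inl_lt {k b : ℕ} (p : Fin k × Fin b) :
    (slotEquiv k b (Sum.inl p) : ℕ) < k * b := by
  simpa [slotEquiv] using (finProdFinEquiv p).2

lemma le_slotEquiv_inr {k b : ℕ} (j : Fin k) :
    k * b ≤ (slotEquiv k b (Sum.inr j) : ℕ) := by
  simp [slotEquiv]

lemma exists_assignment {k b : ℕ} (σ : ℕ → Slot k b → Bool) :
    ∃ τ : Var → Bool, ∀ i p, τ (slotVar k b i p) = σ i p := by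
  refine ⟨fun x => if h : 0 < k * b + k then
    σ (x / (k * b + k)) ((slotEquiv k b).symm ⟨x % (k * b + k), Nat.mod_lt _ h⟩) else false, ?_⟩
  intro i p
  have hlt := (slotEquiv k b p).2
  have hpos : 0 < k * b + k := by omega
  have hdiv : slotVar k b i p / (k * b + k) = i := by
    rw [slotVar, Nat.mul_comm, Nat.mul_add_div hpos, Nat.div_eq_of_lt hlt, Nat.add_zero]
  have hmod : slotVar k b i p % (k * b + k) = slotEquiv k b p := by
    rw [slotVar, Nat.mul_comm, Nat.mul_add_mod, Nat.mod_eq_of_lt hlt]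
  simp only [hpos, dif_pos, hdiv, hmod, Fin.eta, Equiv.symm_apply_apply]

/-- The clause saying that the bits of token `j` at time `i` do not spell `a`. -/
def neqClause (k b i : ℕ) (j : Fin k) (a : Fin b → Bool) : Clause :=
  Finset.univ.image fun t => (slotVar k b i (Sum.inl (j, t)), !a t)

/-- The bits of token `j` at time `i`. -/
def register {k b : ℕ} (τ : Var → Bool) (i : ℕ) (j : Fin k) : Fin b → Bool :=
  fun t => τ (slotVar k b i (Sum.inl (j, t)))

lemma satC_neqClause {k b i : ℕ} {j : Fin k} {a : Fin b → Bool} {τ : Var → Bool} :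
    SatC τ (neqClause k b i j a) ↔ register τ i j ≠ a := by
  simp only [SatC, neqClause, Finset.mem_image, Finset.mem_univ, true_and, exists_exists_eq_and,
    Function.ne_iff, register]
  exact exists_congr fun t => by rw [← Bool.eq_not]

lemma clauseVars_union (c d : Clause) : clauseVars (c ∪ d) = clauseVars c ∪ clauseVars d :=
  Finset.image_union _ _

lemma mem_clauseVars_neqClause {k b i : ℕ} {j : Fin k} {a : Fin b → Bool} {x : ℕ}
    (hx : x ∈ clauseVars (neqClause k b i j a)) :
    i * (k * b + k) ≤ x ∧ x ≤ i * (k * b + k) + (k * b + k) := by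
  simp only [clauseVars, neqClause, Finset.mem_image, Finset.mem_univ, true_and] at hx
  obtain ⟨_, ⟨t, rfl⟩, rfl⟩ := hx
  have := slotEquiv_inl_lt (j, t)
  simp only [slotVar]
  omega

/-- The clause saying that bit `t` of token `j` does not change from `c` complemented at time
`i` to `c` at time `i + 1` unless the token is flagged. -/
def keepClause (k b i : ℕ) (j : Fin k) (t : Fin b) (c : Bool) : Clause :=
  {(slotVar k b i (Sum.inr j), true), (slotVar k b i (Sum.inl (j, t)), c),
    (slotVar k b (i + 1) (Sum.inl (j, t)), !c)}

/-- The clause saying that tokens `j` and `j'` are not both flagged at time `i`. -/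
def flagClause (k b i : ℕ) (j j' : Fin k) : Clause :=
  {(slotVar k b i (Sum.inr j), false), (slotVar k b i (Sum.inr j'), false)}

variable {V : Type*} (G : SimpleGraph V) (k b ℓ : ℕ) (S T : Finset V)
  (dec : (Fin b → Bool) → V)

/-- The formula stating that the decoded registers form a trajectory from `S` to `T`. -/
noncomputable def reachCNF : CNF :=
  family (ι := Fin (ℓ + 1) × Fin k × Fin k × (Fin b → Bool) × (Fin b → Bool))
      (fun q => q.2.1 ≠ q.2.2.1 ∧ (dec q.2.2.2.1 = dec q.2.2.2.2 ∨
        G.Adj (dec q.2.2.2.1) (dec q.2.2.2.2)))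
      (fun q => neqClause k b q.1 q.2.1 q.2.2.2.1 ∪ neqClause k b q.1 q.2.2.1 q.2.2.2.2) ++
    (family (ι := Fin k × (Fin b → Bool)) (fun q => dec q.2 ∉ S)
      (fun q => neqClause k b 0 q.1 q.2) ++
    (family (ι := Fin k × (Fin b → Bool)) (fun q => dec q.2 ∉ T)
      (fun q => neqClause k b ℓ q.1 q.2) ++
    (family (ι := Fin ℓ × Fin k × Fin b × Bool) (fun _ => True)
      (fun q => keepClause k b q.1 q.2.1 q.2.2.1 q.2.2.2) ++
    family (ι := Fin ℓ × Fin k × Fin k) (fun q => q.2.1 ≠ q.2.2)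
      (fun q => flagClause k b q.1 q.2.1 q.2.2))))

lemma length_reachCNF_le :
    (reachCNF G k b ℓ S T dec).length ≤
      (ℓ + 1) * (k * (k * (2 ^ b * 2 ^ b))) + (k * 2 ^ b + (k * 2 ^ b +
        (ℓ * (k * (b * 2)) + ℓ * (k * k)))) := by
  simp only [reachCNF, List.length_append]
  gcongr <;> refine (length_family_le _ _).trans_eq ?_ <;> simp

lemma reachCNF_window {c : Clause} (hc : c ∈ reachCNF G k b ℓ S T dec) :
    ∃ t ≤ ℓ * (k * b + k), ∀ x : ℕ, x ∈ clauseVars c → t ≤ x ∧ x ≤ t + (k * b + k) := by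
  simp only [reachCNF, List.mem_append, mem_family] at hc
  rcases hc with ⟨⟨i, j, j', a, a'⟩, -, rfl⟩ | ⟨⟨j, a⟩, -, rfl⟩ | ⟨⟨j, a⟩, -, rfl⟩ |
    ⟨⟨i, j, t, c⟩, -, rfl⟩ | ⟨⟨i, j, j'⟩, -, rfl⟩
  · refine ⟨i * (k * b + k), Nat.mul_le_mul_right _ (Nat.lt_succ_iff.1 i.2), fun x hx => ?_⟩
    rw [clauseVars_union, Finset.mem_union] at hx
    exact hx.elim mem_clauseVars_neqClause mem_clauseVars_neqClause
  · exact ⟨0 * (k * b + k), by simp, fun x hx => mem_clauseVars_neqClause hx⟩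
  · exact ⟨ℓ * (k * b + k), le_rfl, fun x hx => mem_clauseVars_neqClause hx⟩
  · have hi : (i + 1) * (k * b + k) ≤ ℓ * (k * b + k) := Nat.mul_le_mul_right _ i.2
    have h1 := slotEquiv_inl_lt (j, t)
    have h2 := le_slotEquiv_inr (b := b) j
    have h3 := (slotEquiv k b (Sum.inr j)).2
    rw [add_mul, one_mul] at hi
    refine ⟨slotVar k b i (Sum.inl (j, t)), by simp only [slotVar]; omega, fun x hx => ?_⟩
    simp only [clauseVars, keepClause, Finset.image_insert, Finset.image_singleton,
      Finset.mem_insert, Finset.mem_singleton, slotVar, add_mul, one_mul] at hx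
    simp only [slotVar]
    omega
  · have hi : i * (k * b + k) ≤ ℓ * (k * b + k) := Nat.mul_le_mul_right _ i.2.le
    have h2 := (slotEquiv k b (Sum.inr j)).2
    have h3 := (slotEquiv k b (Sum.inr j')).2
    refine ⟨i * (k * b + k), hi, fun x hx => ?_⟩
    simp only [clauseVars, flagClause, Finset.image_insert, Finset.image_singleton,
      Finset.mem_insert, Finset.mem_singleton, slotVar] at hx
    omega

lemma forall_satC_keepClause {k b i : ℕ} {j : Fin k} {τ : Var → Bool} :
    (∀ (t : Fin b) (c : Bool), SatC τ (keepClause k b i j t c)) ↔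
      (τ (slotVar k b i (Sum.inr j)) = true ∨
        (register τ i j : Fin b → Bool) = register τ (i + 1) j) := by
  simp only [SatC, keepClause, Finset.mem_insert, Finset.mem_singleton, exists_eq_or_imp,
    exists_eq_left, Bool.forall_bool, funext_iff, register]
  generalize τ (slotVar k b i (Sum.inr j)) = m
  cases m
  · simp only [Bool.false_eq_true, false_or]
    refine forall_congr' fun t => ?_
    generalize τ (slotVar k b i (Sum.inl (j, t))) = u
    generalize τ (slotVar k b (i + 1) (Sum.inl (j, t))) = v
    revert u v
    decide
  · simp

lemma satC_flagClause {k b i : ℕ} {j j' : Fin k} {τ : Var → Bool} :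
    SatC τ (flagClause k b i j j') ↔
      τ (slotVar k b i (Sum.inr j)) = false ∨ τ (slotVar k b i (Sum.inr j')) = false := by
  simp [SatC, flagClause]

lemma sat_reachCNF {τ : Var → Bool} :
    Sat τ (reachCNF G k b ℓ S T dec) ↔
      (∀ i ≤ ℓ, Spread G fun j : Fin k => dec (register τ i j)) ∧
      (∀ j : Fin k, dec (register τ 0 j) ∈ S) ∧
      (∀ j : Fin k, dec (register τ ℓ j) ∈ T) ∧
      (∀ i < ℓ, ∀ j : Fin k, τ (slotVar k b i (Sum.inr j)) = true ∨
        (register τ i j : Fin b → Bool) = register τ (i + 1) j) ∧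
      (∀ i < ℓ, ∀ j j' : Fin k, j ≠ j' →
        τ (slotVar k b i (Sum.inr j)) = false ∨ τ (slotVar k b i (Sum.inr j')) = false) := by
  simp only [reachCNF, sat_append, sat_family, satC_union, satC_neqClause, satC_flagClause,
    Prod.forall, true_imp_iff]
  refine and_congr ?_ (and_congr ?_ (and_congr ?_ (and_congr ?_ ?_)))
  · constructor
    · intro h i hi j j' hj
      have := h ⟨i, Nat.lt_succ_iff.2 hi⟩ j j' (register τ i j) (register τ i j')
      simp only [ne_eq, not_true_eq_false, or_self, imp_false, not_and_or, not_or] at this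
      exact this.resolve_left (not_not.2 hj)
    · rintro h i j j' a a' ⟨hj, hd⟩
      by_contra! hn
      obtain ⟨rfl, rfl⟩ := hn
      have := h i (Nat.lt_succ_iff.1 i.2) j j' hj
      exact hd.elim this.1 this.2
  · refine forall_congr' fun j => ⟨fun h => ?_, fun h a ha e => ha (e ▸ h)⟩
    by_contra hn
    exact h _ hn rfl
  · refine forall_congr' fun j => ⟨fun h => ?_, fun h a ha e => ha (e ▸ h)⟩
    by_contra hn
    exact h _ hn rfl
  · exact ⟨fun h i hi j => forall_satC_keepClause.1 (h ⟨i, hi⟩ j),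
      fun h i j => forall_satC_keepClause.2 (h i i.2 j)⟩
  · exact ⟨fun h i hi => h ⟨i, hi⟩, fun h i => h i i.2⟩

lemma satisfiable_reachCNF {enc : V → Fin b → Bool} (hdec : Function.LeftInverse dec enc) :
    Satisfiable (reachCNF G k b ℓ S T dec) ↔
      ∃ F : ℕ → Fin k → V, IsTrajectory G ℓ F ∧ (∀ j, F 0 j ∈ S) ∧ ∀ j, F ℓ j ∈ T := by
  simp only [Satisfiable, sat_reachCNF]
  constructor
  · rintro ⟨τ, hspread, hS, hT, hkeep, hflag⟩
    refine ⟨fun i j => dec (register τ i j), ⟨hspread, fun i hi j j' hj => ?_⟩, hS, hT⟩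
    rcases hflag i hi j j' hj with h | h
    · exact Or.inl (congrArg dec ((hkeep i hi j).resolve_left (by simp [h])))
    · exact Or.inr (congrArg dec ((hkeep i hi j').resolve_left (by simp [h])))
  · rintro ⟨F, hF, hS, hT⟩
    obtain ⟨τ, hτ⟩ := exists_assignment (k := k) (b := b) fun i =>
      Sum.elim (fun p => enc (F i p.1) p.2) fun j => decide (F i j ≠ F (i + 1) j)
    have hreg : ∀ i (j : Fin k), register τ i j = enc (F i j) := by
      intro i j
      funext t
      simp [register, hτ]
    refine ⟨τ, ?_⟩
    simp only [hreg, hdec _, hτ, Sum.elim_inr, decide_eq_true_eq, decide_eq_false_iff_not, not_not]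
    refine ⟨hF.1, hS, hT, fun i _ j => ?_, hF.2⟩
    by_cases h : F i j = F (i + 1) j
    · exact Or.inr (congrArg enc h)
    · exact Or.inl h

end Encoding

/-- There is an absolute constant `C` such that: for every simple graph
`G` on `n ≥ 2` vertices, every `k ≥ 1`, all independent sets `S`, `T` of size `k` and
every `ℓ ≥ 1`, there is a CNF formula `φ` with at most `(n + ℓ + k)^C` variables and
clauses, together with a path decomposition of width at most `k·⌈log₂ n⌉ + C·k`, such
that `φ` is satisfiable iff `S` can be transformed into `T` by at most `ℓ` token-jumping
moves in `G`. -/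
theorem stmt18 : ∃ C : ℕ, ∀ (V : Type) [Fintype V] [DecidableEq V],
    ∀ (G : SimpleGraph V) (k ℓ : ℕ) (S T : Finset V),
    2 ≤ Fintype.card V → 1 ≤ k → 1 ≤ ℓ →
    S.card = k → T.card = k → IndepSet G S → IndepSet G T →
    ∃ (φ : CNF) (B : List (Finset Var)),
      (cnfVars φ).card ≤ (Fintype.card V + ℓ + k) ^ C ∧
      φ.length ≤ (Fintype.card V + ℓ + k) ^ C ∧
      PD φ (k * Nat.clog 2 (Fintype.card V) + C * k) B ∧
      (Satisfiable φ ↔ TJReach G k ℓ S T) := by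
  refine ⟨10, fun V _ _ G k ℓ S T hn hk hℓ hS hT _ _ => ?_⟩
  set n := Fintype.card V with hn_def
  set b := Nat.clog 2 n with hb_def
  have hVne : Nonempty V := Fintype.card_pos_iff.1 (by omega)
  obtain ⟨enc⟩ : Nonempty (V ↪ (Fin b → Bool)) := by
    apply Function.Embedding.nonempty_of_card_le
    simpa using Nat.le_pow_clog one_lt_two n
  have hdec : Function.LeftInverse (Function.invFun enc) enc :=
    Function.leftInverse_invFun enc.injective
  have hwin : ∀ c ∈ reachCNF G k b ℓ S T (Function.invFun enc), _ :=
    fun c hc => reachCNF_window G k b ℓ S T _ hc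
  have hb : b ≤ n := Nat.clog_le_of_le_pow Nat.lt_two_pow_self.le
  set s := n + ℓ + k with hs
  have hpow : 2 ^ b ≤ s ^ 2 := by
    have h1 : 2 ^ (b - 1) < n := Nat.pow_pred_clog_lt_self one_lt_two hn
    have h2 : 2 ^ b ≤ 2 * 2 ^ (b - 1) := by
      rw [← pow_succ']
      exact Nat.pow_le_pow_right two_pos (by omega)
    nlinarith
  have hs4 : 4 ≤ s := by omega
  refine ⟨reachCNF G k b ℓ S T (Function.invFun enc),
    windows (reachCNF G k b ℓ S T (Function.invFun enc)) (ℓ * (k * b + k)) (k * b + k),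
    ?_, ?_, pd_windows (by omega) hwin, ?_⟩
  · refine (card_cnfVars_le_of_windows hwin).trans ?_
    calc ℓ * (k * b + k) + (k * b + k) + 1 = (ℓ + 1) * (k * (b + 1)) + 1 := by ring
      _ ≤ s * (s * s) + s * (s * s) := by
          gcongr
          · omega
          · omega
          · omega
          · exact Nat.mul_pos (by omega) (Nat.mul_pos (by omega) (by omega))
      _ = 2 * s ^ 3 := by ring
      _ ≤ s ^ 7 * s ^ 3 := by
          gcongr
          exact (show 2 ≤ s by omega).trans (Nat.le_self_pow (by norm_num) s)
      _ = s ^ 10 := by ring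
  · refine (length_reachCNF_le G k b ℓ S T _).trans ?_
    have hs1 : 1 ≤ s := by omega
    calc (ℓ + 1) * (k * (k * (2 ^ b * 2 ^ b))) + (k * 2 ^ b + (k * 2 ^ b +
            (ℓ * (k * (b * 2)) + ℓ * (k * k))))
        ≤ s * (s * (s * (s ^ 2 * s ^ 2))) + (s * s ^ 2 + (s * s ^ 2 +
            (s * (s * (s * s)) + s * (s * s)))) := by gcongr <;> omega
      _ = s ^ 7 + (s ^ 3 + (s ^ 3 + (s ^ 4 + s ^ 3))) := by ring
      _ ≤ s ^ 7 + (s ^ 7 + (s ^ 7 + (s ^ 7 + s ^ 7))) := by gcongr <;> norm_num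
      _ = 5 * s ^ 7 := by ring
      _ ≤ s ^ 3 * s ^ 7 := by
          gcongr
          nlinarith [Nat.pow_le_pow_left hs4 3]
      _ = s ^ 10 := by ring
  · rw [satisfiable_reachCNF G k b ℓ S T _ hdec, tjReach_iff_exists_isTrajectory hS hT]

end PPSETH
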